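/- arXiv:2410.20226 — 2 statements merged into one kernel-verified Lean document; each statement's English description precedes it below -/
import Mathlib

section
/- Let G be an almost Moore digraph of degree d > 1 and diameter k > 1, and let φ be an automorphism of G. If u and v are two distinct vertices of G that are fixed by φ, then every walk of length at most k from u to v is fixed (vertex-wise) by φ². -/
/-- `IsWalkFrom A u v l` : the list `u :: l` is a directed walk from `u` to `v`
along the adjacency relation `A`; the length of the walk is `l.length`. -/
def IsWalkFrom {V : Type} (A : V → V → Prop) (u v : V) (l : List V) : Prop :=
  List.Chain A u l ∧ (u :: l).getLast (List.cons_ne_nil u l) = v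

/-- An almost Moore digraph (a `(d,k)`-digraph): a diregular digraph of degree `d > 1`,
diameter `k > 1` and order `d + d² + ⋯ + d^k`, together with its repeat permutation `rep`:
for every vertex `v`, every vertex `w ≠ rep v` is reached from `v` by exactly one walk of
length at most `k`, while `rep v` is reached by exactly two such walks, at least one of
which has length `k`.  The map `rep` is an automorphism of the digraph. -/
structure AlmostMooreDigraph (d k : ℕ) where
  hd : 1 < d
  hk : 1 < k
  V : Type
  [fintypeV : Fintype V]
  [decEqV : DecidableEq V]
  Adj : V → V → Prop
  [adjDec : DecidableRel Adj]
  loopless : ∀ v, ¬ Adj v v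
  out_deg : ∀ v, {w | Adj v w}.ncard = d
  in_deg : ∀ v, {w | Adj w v}.ncard = d
  reach : ∀ u v, ∃ l, IsWalkFrom Adj u v l ∧ l.length ≤ k
  diam : ∃ u v, ∀ l, IsWalkFrom Adj u v l → k ≤ l.length
  card_eq : Fintype.card V = ∑ i ∈ Finset.range k, d ^ (i + 1)
  rep : V → V
  rep_spec : ∀ v w, w ≠ rep v → ∃! l, IsWalkFrom Adj v w l ∧ l.length ≤ k
  rep_two : ∀ v, ∃ l₁ l₂, l₁ ≠ l₂ ∧
      IsWalkFrom Adj v (rep v) l₁ ∧ l₁.length ≤ k ∧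
      IsWalkFrom Adj v (rep v) l₂ ∧ l₂.length ≤ k ∧
      (l₁.length = k ∨ l₂.length = k) ∧
      (∀ l, IsWalkFrom Adj v (rep v) l → l.length ≤ k → l = l₁ ∨ l = l₂)
  rep_bijective : Function.Bijective rep
  rep_adj : ∀ u v, Adj u v ↔ Adj (rep u) (rep v)

attribute [instance] AlmostMooreDigraph.fintypeV AlmostMooreDigraph.decEqV
  AlmostMooreDigraph.adjDec

/-- `ordRep M v` : the smallest `t ≥ 1` with `rep^t v = v`. -/
noncomputable def ordRep {d k : ℕ} (M : AlmostMooreDigraph d k) (v : M.V) : ℕ :=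
  sInf {t | 0 < t ∧ M.rep^[t] v = v}

/-- The vertex set of the subdigraph `H_α`: vertices whose order under the repeat
permutation divides `2^t * α` for some `t ≥ 0`. -/
def Hset {d k : ℕ} (M : AlmostMooreDigraph d k) (α : ℕ) : Set M.V :=
  {v | ∃ t : ℕ, ordRep M v ∣ 2 ^ t * α}

theorem IsWalkFrom.map {V W : Type} {A : V → V → Prop} {B : W → W → Prop} {f : V → W}
    (hf : ∀ a b, A a b → B (f a) (f b)) {u v : V} {l : List V} (h : IsWalkFrom A u v l) :
    IsWalkFrom B (f u) (f v) (l.map f) := by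
  obtain ⟨hc, hl⟩ := h
  refine ⟨?_, ?_⟩
  · exact List.isChain_map_of_isChain f hf hc
  · rw [← hl]
    exact List.getLast_map (l := u :: l) (by simp)

/-- Let `G` be an almost Moore digraph of degree `d > 1` and diameter
`k > 1`, and let `φ` be an automorphism of `G`.  If `u` and `v` are two distinct vertices
fixed by `φ`, then every walk of length at most `k` from `u` to `v` is fixed vertex-wise
by `φ²`. -/
theorem stmt0 {d k : ℕ} (M : AlmostMooreDigraph d k) (φ : M.V → M.V)
    (hφbij : Function.Bijective φ) (hφadj : ∀ a b, M.Adj a b ↔ M.Adj (φ a) (φ b))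
    (u v : M.V) (huv : u ≠ v) (hu : φ u = u) (hv : φ v = v) :
    ∀ l : List M.V, IsWalkFrom M.Adj u v l → l.length ≤ k →
      (u :: l).map (φ ∘ φ) = u :: l := by
  have maps : ∀ l, IsWalkFrom M.Adj u v l → IsWalkFrom M.Adj u v (l.map φ) := fun l h => by
    simpa only [hu, hv] using h.map fun a b => (hφadj a b).1
  have inj : Function.Injective (List.map φ) := List.map_injective_iff.2 hφbij.1
  intro l hl hlen
  suffices hfix : (l.map φ).map φ = l by
    rw [List.map_map] at hfix
    simp [hfix, hu]
  have hl' := maps l hl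
  have hlen' : (l.map φ).length ≤ k := by simpa using hlen
  have hl'' := maps _ hl'
  have hlen'' : ((l.map φ).map φ).length ≤ k := by simpa using hlen
  by_cases hr : v = M.rep u
  · obtain ⟨l₁, l₂, -, -, -, -, -, -, two⟩ := M.rep_two u
    rw [← hr] at two
    have h := two l hl hlen
    have h' := two _ hl' hlen'
    have h'' := two _ hl'' hlen''
    have step : (l.map φ).map φ = l.map φ → (l.map φ).map φ = l := fun e => by
      rw [e, inj e]
    grind
  · exact (M.rep_spec u v hr).unique ⟨hl'', hlen''⟩ ⟨hl, hlen⟩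
end

section
/- Let d ≥ 6 and k be integers with k even and k ≥ 2(d−1)². Then there exists a prime ℓ such that gcd(ℓ,k) = 1 and 1 < ℓ < (k+1)/(d−1). -/
/-- Let `d ≥ 6` and let `k` be even with `k ≥ 2(d−1)²`.  Then there
exists a prime `ℓ` such that `gcd(ℓ, k) = 1` and `1 < ℓ < (k+1)/(d−1)` (the latter
expressed as `ℓ(d−1) < k+1`). -/
theorem stmt16 (d k : ℕ) (hd : 6 ≤ d) (hk : Even k) (hk2 : 2 * (d - 1) ^ 2 ≤ k) :
    ∃ ℓ : ℕ, ℓ.Prime ∧ Nat.gcd ℓ k = 1 ∧ 1 < ℓ ∧ ℓ * (d - 1) < k + 1 := by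
  obtain ⟨n, hn⟩ : ∃ n, n = d - 1 := ⟨_, rfl⟩
  rw [← hn] at hk2 ⊢
  have hn5 : 5 ≤ n := by omega
  by_contra! hno
  have hdvd : ∀ p : ℕ, p.Prime → p ≤ k / n → p ∣ k := by
    intro p hp hpm
    by_contra hpk
    have := hno p hp ((Nat.Prime.coprime_iff_not_dvd hp).2 hpk) hp.one_lt
    have := (Nat.le_div_iff_mul_le (by omega)).1 hpm
    omega
  have hm : 2 * n ≤ k / n := (Nat.le_div_iff_mul_le (by omega)).2 (by linarith)
  have hkm : k < n * (k / n + 1) := Nat.lt_mul_div_succ k (by omega)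
  obtain ⟨q, hq, hmq, hqm⟩ := Nat.exists_prime_lt_and_le_two_mul (k / n / 2) (by omega)
  obtain ⟨r, hr, hqr, hrq⟩ := Nat.exists_prime_lt_and_le_two_mul ((q - 1) / 2) (by omega)
  have hq2 : q % 2 = 1 := Nat.odd_iff.1 (hq.odd_of_ne_two (by omega))
  have hr2 : r % 2 = 1 := Nat.odd_iff.1 (hr.odd_of_ne_two (by omega))
  have hk0 : 0 < k := by nlinarith
  have hc {a b : ℕ} (ha : a.Prime) (hb : b.Prime) (hab : a ≠ b) : a.Coprime b :=
    (Nat.coprime_primes ha hb).2 hab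
  have h6 : 2 * 3 ∣ k := (hc Nat.prime_two Nat.prime_three (by omega)).mul_dvd_of_dvd_of_dvd
    hk.two_dvd (hdvd 3 Nat.prime_three (by omega))
  have hqrk : q * r ∣ k := (hc hq hr (by omega)).mul_dvd_of_dvd_of_dvd
    (hdvd q hq (by omega)) (hdvd r hr (by omega))
  have hcop : Nat.Coprime (2 * 3) (q * r) :=
    .mul_left
      (.mul_right (hc Nat.prime_two hq (by omega)) (hc Nat.prime_two hr (by omega)))
      (.mul_right (hc Nat.prime_three hq (by omega)) (hc Nat.prime_three hr (by omega)))
  have hle : 2 * 3 * (q * r) ≤ k := Nat.le_of_dvd hk0 (hcop.mul_dvd_of_dvd_of_dvd h6 hqrk)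
  have hub : n * (k / n + 1) ≤ 2 * r * (2 * q) := Nat.mul_le_mul (by omega) (by omega)
  have hpos : 0 < q * r := Nat.mul_pos hq.pos hr.pos
  nlinarith
end
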